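/- Let q be an odd prime power and F = F_q. The subspace W₃ = {[[a,0,c],[0,b,0],[c,0,0]] : a,b,c ∈ F} of Sym₃(F) (a representative of the orbit Σ₃) has point-orbit distribution [2, (3q−1)/2, (q−1)/2, q²−q]. -/

import Mathlib

open Matrix

/-- The number of points (1-dimensional subspaces) contained in a set `S` of `3 × 3`
matrices whose (nonzero) spanning matrices satisfy the property `P`. -/
noncomputable def ptsWith (F : Type*) [Field F] (S : Set (Matrix (Fin 3) (Fin 3) F))
    (P : Matrix (Fin 3) (Fin 3) F → Prop) : ℕ :=
  Set.ncard {p : Submodule F (Matrix (Fin 3) (Fin 3) F) |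
    ↑p ⊆ S ∧ Module.finrank F ↥p = 1 ∧ ∃ M ∈ p, M ≠ 0 ∧ P M}

/-- A matrix is exterior if it is congruent to `diag(1, −1, 0)`. -/
def Exterior {F : Type*} [Field F] (M : Matrix (Fin 3) (Fin 3) F) : Prop :=
  ∃ A : Matrix (Fin 3) (Fin 3) F, IsUnit A ∧ A * M * Aᵀ = diagonal ![1, -1, 0]

/-- A matrix is interior if it is congruent to `diag(1, −ε, 0)` for some nonsquare `ε`. -/
def Interior {F : Type*} [Field F] (M : Matrix (Fin 3) (Fin 3) F) : Prop :=
  ∃ (A : Matrix (Fin 3) (Fin 3) F) (ε : F), IsUnit A ∧ ¬ IsSquare ε ∧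
    A * M * Aᵀ = diagonal ![1, -ε, 0]

/-- `S` has point-orbit distribution `[n₁, n₂, n₃, n₄]`: it contains `n₁` rank-1 points,
`n₂` exterior rank-2 points, `n₃` interior rank-2 points and `n₄` rank-3 points. -/
def HasPointOrbitDistribution (F : Type*) [Field F] (S : Set (Matrix (Fin 3) (Fin 3) F))
    (n₁ n₂ n₃ n₄ : ℕ) : Prop :=
  ptsWith F S (fun M => M.rank = 1) = n₁ ∧
  ptsWith F S Exterior = n₂ ∧
  ptsWith F S Interior = n₃ ∧
  ptsWith F S (fun M => M.rank = 3) = n₄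

section Points

variable {F : Type*} [Field F]

/-- Points of `S` with property `P` are counted by any family of pairwise non-proportional
representatives. -/
theorem ptsWith_eq_ncard {α : Type*} {S : Set (Matrix (Fin 3) (Fin 3) F)}
    {P : Matrix (Fin 3) (Fin 3) F → Prop} (T : Set α) (f : α → Matrix (Fin 3) (Fin 3) F)
    (hS : ∀ i ∈ T, ∀ t : F, t • f i ∈ S) (h0 : ∀ i ∈ T, f i ≠ 0) (hP : ∀ i ∈ T, P (f i))
    (hinj : ∀ i ∈ T, ∀ j ∈ T, ∀ t : F, f i = t • f j → i = j)
    (hsurj : ∀ M ∈ S, M ≠ 0 → P M → ∃ i ∈ T, ∃ t : F, M = t • f i) :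
    ptsWith F S P = T.ncard := by
  have himage : {p : Submodule F (Matrix (Fin 3) (Fin 3) F) |
      ↑p ⊆ S ∧ Module.finrank F ↥p = 1 ∧ ∃ M ∈ p, M ≠ 0 ∧ P M} =
      (fun i => Submodule.span F {f i}) '' T := by
    ext p
    constructor
    · rintro ⟨hpS, hp, M, hM, hM0, hPM⟩
      obtain ⟨i, hi, t, rfl⟩ := hsurj M (hpS hM) hM0 hPM
      refine ⟨i, hi, ?_⟩
      have ht : t ≠ 0 := fun h => hM0 (by simp [h])
      have hfp : f i ∈ p := by simpa [smul_smul, ht] using p.smul_mem t⁻¹ hM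
      have : FiniteDimensional F p := Module.finite_of_finrank_eq_succ hp
      exact Submodule.eq_of_le_of_finrank_eq (by simpa using hfp)
        (by rw [finrank_span_singleton (h0 i hi), hp])
    · rintro ⟨i, hi, rfl⟩
      refine ⟨fun M hM => ?_, finrank_span_singleton (h0 i hi), f i,
        Submodule.mem_span_singleton_self _, h0 i hi, hP i hi⟩
      obtain ⟨t, rfl⟩ := Submodule.mem_span_singleton.1 hM
      exact hS i hi t
  rw [ptsWith, himage, Set.InjOn.ncard_image]
  intro i hi j hj hij
  have hmem : f i ∈ Submodule.span F {f j} := by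
    rw [← show Submodule.span F {f i} = Submodule.span F {f j} from hij]
    exact Submodule.mem_span_singleton_self _
  obtain ⟨t, ht⟩ := Submodule.mem_span_singleton.1 hmem
  exact hinj i hi j hj t ht.symm

end Points

section SquareCount

variable (F : Type*) [Field F] [Fintype F]

theorem ringChar_ne_two_of_odd_card (hodd : Odd (Fintype.card F)) : ringChar F ≠ 2 := by
  intro h
  have := FiniteField.even_card_of_char_two h
  rw [Nat.odd_iff] at hodd
  omega

theorem ncard_nonzero_squares_and_nonsquares (hodd : Odd (Fintype.card F)) :
    {e : F | e ≠ 0 ∧ IsSquare e}.ncard = (Fintype.card F - 1) / 2 ∧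
      {e : F | ¬ IsSquare e}.ncard = (Fintype.card F - 1) / 2 := by
  classical
  have hsum := quadraticChar_sum_zero (ringChar_ne_two_of_odd_card F hodd)
  have hchar : ∀ a : F, quadraticChar F a =
      (if a ≠ 0 ∧ IsSquare a then 1 else 0) - (if ¬ IsSquare a then 1 else 0) := by
    intro a
    by_cases ha : a = 0
    · simp [ha]
    by_cases hsq : IsSquare a
    · simp [ha, hsq, (quadraticChar_one_iff_isSquare ha).2 hsq]
    · simp [hsq, quadraticChar_neg_one_iff_not_isSquare.2 hsq]
  have hone : ∀ a : F, 1 = (if a = 0 then 1 else 0) +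
      (if a ≠ 0 ∧ IsSquare a then 1 else 0) + (if ¬ IsSquare a then 1 else 0) := by
    intro a
    by_cases ha : a = 0
    · simp [ha]
    by_cases hsq : IsSquare a <;> simp [ha, hsq]
  have hcard : Fintype.card F = ∑ a : F, 1 := by simp
  rw [Finset.sum_congr rfl fun a _ => hone a, Finset.sum_add_distrib, Finset.sum_add_distrib,
    Finset.sum_ite_eq' Finset.univ (0 : F), ← Finset.card_filter, ← Finset.card_filter] at hcard
  rw [Finset.sum_congr rfl fun a _ => hchar a, Finset.sum_sub_distrib, Finset.sum_boole,
    Finset.sum_boole] at hsum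
  rw [Set.ncard_eq_toFinset_card', Set.ncard_eq_toFinset_card', Set.toFinset_ofPred,
    Set.toFinset_ofPred]
  simp only [Finset.mem_univ, if_true] at hcard
  omega

end SquareCount

section Congruence

variable {F : Type*} [Field F]

theorem det_submatrix_eq_zero_of_rank_eq_one {M : Matrix (Fin 3) (Fin 3) F} (hM : M.rank = 1)
    (r c : Fin 2 → Fin 3) : (M.submatrix r c).det = 0 := by
  by_contra h
  have h2 := rank_of_det_ne_zero h
  have hle := rank_submatrix_le M r c
  simp only [Fintype.card_fin] at h2
  omega

theorem det_ne_zero_of_rank_eq_three {M : Matrix (Fin 3) (Fin 3) F} (hM : M.rank = 3) :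
    M.det ≠ 0 := by
  rw [← isUnit_iff_ne_zero, ← isUnit_iff_isUnit_det, ← linearIndependent_rows_iff_isUnit,
    linearIndependent_iff_card_eq_finrank_span, Set.finrank, ← rank_eq_finrank_span_row, hM]
  rfl

theorem rank_eq_one_of_eq_vecMulVec {M : Matrix (Fin 3) (Fin 3) F} (hM : M ≠ 0)
    {v w : Fin 3 → F} (h : M = vecMulVec v w) : M.rank = 1 := by
  have hle : M.rank ≤ 1 := h ▸ rank_vecMulVec_le v w
  have hne : M.rank ≠ 0 := by
    intro h0
    rw [rank, Module.finrank_zero_iff, Submodule.subsingleton_iff_eq_bot,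
      LinearMap.range_eq_bot] at h0
    exact hM (toLin'.map_eq_zero_iff.1 h0)
  omega

/-- The matrix `[[a, 0, c], [0, b, 0], [c, 0, 0]]` with coordinates `(a, b, c)`. -/
def sigmaMatrix (x : F × F × F) : Matrix (Fin 3) (Fin 3) F :=
  !![x.1, 0, x.2.2; 0, x.2.1, 0; x.2.2, 0, 0]

theorem sigmaMatrix_injective : Function.Injective (sigmaMatrix (F := F)) := by
  rintro ⟨a, b, c⟩ ⟨a', b', c'⟩ h
  have h0 := congrFun₂ h 0 0
  have h1 := congrFun₂ h 1 1
  have h2 := congrFun₂ h 0 2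
  simp_all [sigmaMatrix]

theorem smul_sigmaMatrix (t : F) (x : F × F × F) :
    t • sigmaMatrix x = sigmaMatrix (t • x) := by
  simp [sigmaMatrix, Matrix.smul_of]

theorem sigmaMatrix_ne_zero {x : F × F × F} (hx : x ≠ 0) : sigmaMatrix x ≠ 0 := by
  have h0 : sigmaMatrix (0 : F × F × F) = 0 := by
    ext i j; fin_cases i <;> fin_cases j <;> rfl
  exact h0 ▸ sigmaMatrix_injective.ne hx

theorem det_sigmaMatrix (a b c : F) : (sigmaMatrix (a, b, c)).det = -(b * c ^ 2) := by
  simp [sigmaMatrix, det_fin_three]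
  ring

theorem sigmaMatrix_rank_eq_one {a b c : F} (h : (sigmaMatrix (a, b, c)).rank = 1) :
    c = 0 ∧ a * b = 0 := by
  have h1 := det_submatrix_eq_zero_of_rank_eq_one h ![0, 2] ![0, 2]
  have h2 := det_submatrix_eq_zero_of_rank_eq_one h ![0, 1] ![0, 1]
  rw [det_fin_two] at h1 h2
  simp [sigmaMatrix] at h1 h2
  simp [h1, h2]

/-- Invariants of a rank-2 matrix in the plane, read off from its congruence to
`diag(1, -e, 0)`. -/
theorem sigmaMatrix_congruent_diagonal {a b c e : F} {A : Matrix (Fin 3) (Fin 3) F}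
    (h : A * sigmaMatrix (a, b, c) * Aᵀ = diagonal ![1, -e, 0]) (hA : IsUnit A) :
    b * c ^ 2 = 0 ∧ (c = 0 → ∃ d, e = -(a * b) * d ^ 2) ∧ (b = 0 → IsSquare e) := by
  have hdet := congrArg det h
  rw [det_mul, det_mul, det_transpose, det_sigmaMatrix] at hdet
  have hA0 : A.det ≠ 0 := ((isUnit_iff_isUnit_det A).1 hA).ne_zero
  have h00 := congrFun₂ h 0 0
  have h01 := congrFun₂ h 0 1
  have h11 := congrFun₂ h 1 1
  simp [sigmaMatrix, Matrix.mul_apply, Fin.sum_univ_three] at h00 h01 h11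
  refine ⟨by simpa [Fin.prod_univ_three, hA0] using hdet, ?_, ?_⟩
  · rintro rfl
    refine ⟨A 0 0 * A 1 1 - A 0 1 * A 1 0, ?_⟩
    linear_combination (-e) * h00 + (A 0 0 * A 0 0 * a + A 0 1 * A 0 1 * b) * h11 -
      (A 1 0 * A 0 0 * a + A 1 1 * A 0 1 * b) * h01
  · rintro rfl
    refine ⟨c * (A 0 0 * A 1 2 - A 0 2 * A 1 0), ?_⟩
    linear_combination (-e) * h00 + (A 0 0 * A 0 0 * a + 2 * A 0 0 * A 0 2 * c) * h11 -
      (A 1 0 * A 0 0 * a + (A 0 0 * A 1 2 + A 0 2 * A 1 0) * c) * h01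

theorem exterior_sigmaMatrix_of_isSquare {e : F} (he : e ≠ 0) (hsq : IsSquare e) :
    Exterior (sigmaMatrix (1, -e, 0)) := by
  obtain ⟨s, rfl⟩ := hsq
  have hs : s ≠ 0 := fun h => he (by simp [h])
  refine ⟨!![1, 0, 0; 0, s⁻¹, 0; 0, 0, 1], ?_, ?_⟩
  · rw [isUnit_iff_isUnit_det, isUnit_iff_ne_zero]
    simp [det_fin_three, hs]
  · ext i j
    fin_cases i <;> fin_cases j <;>
      simp [sigmaMatrix, Matrix.mul_apply, Fin.sum_univ_three, hs]

theorem exterior_sigmaMatrix_hyperbolic (h2 : (2 : F) ≠ 0) (a : F) :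
    Exterior (sigmaMatrix (a, 0, 1)) := by
  refine ⟨!![1, 0, (1 - a) / 2; 1, 0, (-1 - a) / 2; 0, 1, 0], ?_, ?_⟩
  · rw [isUnit_iff_isUnit_det, isUnit_iff_ne_zero]
    have : (1 - a) / 2 + (1 + a) / 2 = 1 := by field_simp; ring
    simp [det_fin_three]
    intro h
    apply one_ne_zero (α := F)
    linear_combination h - this
  · ext i j
    fin_cases i <;> fin_cases j <;>
      simp [sigmaMatrix, Matrix.mul_apply, Fin.sum_univ_three] <;> field_simp <;> ring

theorem interior_sigmaMatrix {e : F} (he : ¬ IsSquare e) :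
    Interior (sigmaMatrix (1, -e, 0)) := by
  refine ⟨1, e, isUnit_one, he, ?_⟩
  ext i j
  fin_cases i <;> fin_cases j <;> simp [sigmaMatrix]

/-- The counting principle for points of the plane, in coordinates. -/
theorem ptsWith_sigma_eq_ncard {P : Matrix (Fin 3) (Fin 3) F → Prop} (T : Set (F × F × F))
    (h0 : 0 ∉ T) (hP : ∀ x ∈ T, P (sigmaMatrix x))
    (hinj : ∀ x ∈ T, ∀ t : F, t • x ∈ T → t = 1)
    (hsurj : ∀ a b c : F, (a, b, c) ≠ 0 → P (sigmaMatrix (a, b, c)) →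
      ∃ x ∈ T, ∃ t : F, (a, b, c) = t • x) :
    ptsWith F {M | ∃ a b c : F, M = !![a, 0, c; 0, b, 0; c, 0, 0]} P = T.ncard := by
  refine ptsWith_eq_ncard T sigmaMatrix ?_ ?_ hP ?_ ?_
  · intro x _ t
    rw [smul_sigmaMatrix]
    exact ⟨_, _, _, rfl⟩
  · exact fun x hx => sigmaMatrix_ne_zero fun h => h0 (h ▸ hx)
  · intro x hx y hy t h
    rw [smul_sigmaMatrix] at h
    have hxy := sigmaMatrix_injective h
    rw [hxy, hinj y hy t (hxy ▸ hx), one_smul]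
  · rintro _ ⟨a, b, c, rfl⟩ hM hPM
    have habc : (a, b, c) ≠ 0 := by
      intro h
      simp only [Prod.mk_eq_zero] at h
      obtain ⟨rfl, rfl, rfl⟩ := h
      exact hM (by ext i j; fin_cases i <;> fin_cases j <;> rfl)
    obtain ⟨x, hx, t, h⟩ := hsurj a b c habc hPM
    exact ⟨x, hx, t, by rw [smul_sigmaMatrix, ← h]; rfl⟩

end Congruence

section Distribution

variable (F : Type*) [Field F]

theorem ptsWith_rank_one_sigma :
    ptsWith F {M | ∃ a b c : F, M = !![a, 0, c; 0, b, 0; c, 0, 0]} (fun M => M.rank = 1) = 2 := by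
  rw [ptsWith_sigma_eq_ncard {(1, 0, 0), (0, 1, 0)}, Set.ncard_pair (by simp)]
  · simp [Prod.ext_iff]
  · intro x hx
    have hx0 : x ≠ 0 := by rintro rfl; simp [Prod.ext_iff] at hx
    rcases hx with rfl | rfl
    · refine rank_eq_one_of_eq_vecMulVec (v := ![1, 0, 0]) (w := ![1, 0, 0])
        (sigmaMatrix_ne_zero hx0) ?_
      ext i j; fin_cases i <;> fin_cases j <;> simp [sigmaMatrix, vecMulVec]
    · refine rank_eq_one_of_eq_vecMulVec (v := ![0, 1, 0]) (w := ![0, 1, 0])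
        (sigmaMatrix_ne_zero hx0) ?_
      ext i j; fin_cases i <;> fin_cases j <;> simp [sigmaMatrix, vecMulVec]
  · rintro x (rfl | rfl) t ht <;> simpa using ht
  · intro a b c _ h
    obtain ⟨rfl, hab⟩ := sigmaMatrix_rank_eq_one h
    rcases mul_eq_zero.1 hab with rfl | rfl
    · exact ⟨(0, 1, 0), by simp, b, by simp⟩
    · exact ⟨(1, 0, 0), by simp, a, by simp⟩

variable [Fintype F]

theorem ptsWith_exterior_sigma (hodd : Odd (Fintype.card F)) :
    ptsWith F {M | ∃ a b c : F, M = !![a, 0, c; 0, b, 0; c, 0, 0]} Exterior =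
      (3 * Fintype.card F - 1) / 2 := by
  have h2 : (2 : F) ≠ 0 := Ring.two_ne_zero (ringChar_ne_two_of_odd_card F hodd)
  rw [ptsWith_sigma_eq_ncard (Set.range (fun a : F => (a, 0, 1)) ∪
    (fun e : F => (1, -e, 0)) '' {e : F | e ≠ 0 ∧ IsSquare e})]
  · rw [Set.ncard_union_eq, Set.ncard_image_of_injective, ← Set.image_univ,
      Set.ncard_image_of_injective, Set.ncard_univ, Nat.card_eq_fintype_card,
      (ncard_nonzero_squares_and_nonsquares F hodd).1]
    · obtain ⟨k, hk⟩ := hodd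
      omega
    · intro x y h; simpa using h
    · intro x y h; simpa using h
    · rw [Set.disjoint_left]
      rintro _ ⟨a, rfl⟩ ⟨e, _, h⟩
      simp at h
  · simp
  · rintro _ (⟨a, rfl⟩ | ⟨e, ⟨he, hsq⟩, rfl⟩)
    · exact exterior_sigmaMatrix_hyperbolic h2 a
    · exact exterior_sigmaMatrix_of_isSquare he hsq
  · rintro _ (⟨a, rfl⟩ | ⟨e, ⟨he, hsq⟩, rfl⟩) t (⟨a', h⟩ | ⟨e', _, h⟩) <;> simp at h
    · exact h.2.symm
    · simp [← h.2.2] at h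
    · exact h.1.symm
  · rintro a b c - ⟨A, hA, h⟩
    obtain ⟨hbc, hd, -⟩ := sigmaMatrix_congruent_diagonal (e := 1) h hA
    by_cases hc : c = 0
    · subst hc
      obtain ⟨d, hd⟩ := hd rfl
      have hne : -(a * b) * d ^ 2 ≠ 0 := hd ▸ one_ne_zero
      simp only [ne_eq, mul_eq_zero, neg_eq_zero, not_or] at hne
      obtain ⟨⟨ha, hb⟩, hd0⟩ := hne
      have hd0 : d ≠ 0 := by simpa using hd0
      refine ⟨_, Or.inr ⟨-(b / a), ⟨by simp [ha, hb], (a * d)⁻¹, ?_⟩, rfl⟩, a, ?_⟩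
      · field_simp
        linear_combination -hd
      · simp; field_simp
    · have hb : b = 0 := by simpa [hc] using hbc
      subst hb
      refine ⟨_, Or.inl ⟨a / c, rfl⟩, c, ?_⟩
      simp; field_simp

theorem ptsWith_interior_sigma (hodd : Odd (Fintype.card F)) :
    ptsWith F {M | ∃ a b c : F, M = !![a, 0, c; 0, b, 0; c, 0, 0]} Interior =
      (Fintype.card F - 1) / 2 := by
  rw [ptsWith_sigma_eq_ncard ((fun e : F => (1, -e, 0)) '' {e : F | ¬ IsSquare e})]
  · rw [Set.ncard_image_of_injective, (ncard_nonzero_squares_and_nonsquares F hodd).2]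
    intro x y h; simpa using h
  · simp
  · rintro _ ⟨e, he, rfl⟩
    exact interior_sigmaMatrix he
  · rintro _ ⟨e, he, rfl⟩ t ⟨e', _, h⟩
    simp at h
    exact h.1.symm
  · rintro a b c - ⟨A, e, hA, he, h⟩
    obtain ⟨hbc, hd, hb⟩ := sigmaMatrix_congruent_diagonal h hA
    have hc : c = 0 := by
      by_contra hc
      exact he (hb (by simpa [hc] using hbc))
    subst hc
    obtain ⟨d, rfl⟩ := hd rfl
    have ha : a ≠ 0 := by rintro rfl; simp at he
    refine ⟨_, ⟨-(b / a), ?_, rfl⟩, a, by simp; field_simp⟩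
    rintro ⟨s, hs⟩
    refine he ⟨s * a * d, ?_⟩
    field_simp at hs
    linear_combination a * d ^ 2 * hs

theorem ptsWith_rank_three_sigma :
    ptsWith F {M | ∃ a b c : F, M = !![a, 0, c; 0, b, 0; c, 0, 0]} (fun M => M.rank = 3) =
      Fintype.card F ^ 2 - Fintype.card F := by
  rw [ptsWith_sigma_eq_ncard (Set.univ ×ˢ {1} ×ˢ {0}ᶜ)]
  · rw [Set.ncard_prod, Set.ncard_prod, Set.ncard_univ, Set.ncard_singleton, Set.ncard_compl,
      Set.ncard_singleton, Nat.card_eq_fintype_card, sq, one_mul, Nat.mul_sub, mul_one]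
  · simp
  · rintro ⟨a, b, c⟩ ⟨-, hb, hc⟩
    rw [rank_of_det_ne_zero, Fintype.card_fin]
    obtain rfl : b = 1 := hb
    rw [det_sigmaMatrix]
    simpa using hc
  · rintro ⟨a, b, c⟩ ⟨-, hb, -⟩ t ⟨-, h, -⟩
    obtain rfl : b = 1 := hb
    simpa using h
  · intro a b c _ h
    have hdet := det_ne_zero_of_rank_eq_three h
    rw [det_sigmaMatrix] at hdet
    have hb : b ≠ 0 := by rintro rfl; simp at hdet
    have hc : c ≠ 0 := by rintro rfl; simp at hdet
    refine ⟨(a / b, 1, c / b), by simp [hb, hc], b, ?_⟩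
    simp; field_simp; simp

end Distribution

/-- The plane `Σ₃` representative has point-orbit distribution
`[2, (3q−1)/2, (q−1)/2, q²−q]`. -/
theorem distribution_Sigma3 (F : Type*) [Field F] [Fintype F]
    (hodd : Odd (Fintype.card F)) :
    HasPointOrbitDistribution F
      {M | ∃ a b c : F, M = !![a, 0, c; 0, b, 0; c, 0, 0]}
      2
      ((3 * Fintype.card F - 1) / 2)
      ((Fintype.card F - 1) / 2)
      (Fintype.card F ^ 2 - Fintype.card F) := by
  exact ⟨ptsWith_rank_one_sigma F, ptsWith_exterior_sigma F hodd,
    ptsWith_interior_sigma F hodd, ptsWith_rank_three_sigma F⟩
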